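/- (Rothberger) If 𝔭 = ℵ₁ then 𝔱 = ℵ₁, i.e. 𝔭 = 𝔱. -/

import Mathlib

open Cardinal Set

/-- `A ⊆* B` : `A \ B` is finite. -/
def AlmostSubset (A B : Set ℕ) : Prop := (A \ B).Finite

/-- Strong finite intersection property: every nonempty finite subfamily has
infinite intersection. -/
def SFIP (F : Set (Set ℕ)) : Prop :=
  ∀ G : Finset (Set ℕ), ↑G ⊆ F → G.Nonempty → Set.Infinite (⋂ A ∈ G, A)

/-- `F` has an infinite pseudointersection. -/
def HasPseudointersection (F : Set (Set ℕ)) : Prop :=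
  ∃ A : Set ℕ, A.Infinite ∧ ∀ B ∈ F, AlmostSubset A B

/-- The pseudointersection number `𝔭`. -/
noncomputable def pseudoNum : Cardinal :=
  sInf { c | ∃ F : Set (Set ℕ), (∀ A ∈ F, A.Infinite) ∧ SFIP F ∧
    ¬ HasPseudointersection F ∧ c = #↥F }

/-- The tower number `𝔱`: least cardinality of a family of infinite subsets of `ℕ`
linearly ordered by `⊇*` with no pseudointersection. -/
noncomputable def towerNum : Cardinal :=
  sInf { c | ∃ F : Set (Set ℕ), (∀ A ∈ F, A.Infinite) ∧
    (∀ A ∈ F, ∀ B ∈ F, AlmostSubset A B ∨ AlmostSubset B A) ∧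
    ¬ HasPseudointersection F ∧ c = #↥F }

theorem AlmostSubset.of_subset {A B : Set ℕ} (h : A ⊆ B) : AlmostSubset A B := by
  simp [AlmostSubset, sdiff_eq_empty.2 h]

theorem AlmostSubset.trans {A B C : Set ℕ} (hAB : AlmostSubset A B) (hBC : AlmostSubset B C) :
    AlmostSubset A C :=
  (hAB.union hBC).subset fun x hx => by
    by_cases hB : x ∈ B
    · exact .inr ⟨hB, hx.2⟩
    · exact .inl ⟨hx.1, hB⟩

theorem AlmostSubset.infinite_inter {A B C : Set ℕ} (h : AlmostSubset A B)
    (hA : (A ∩ C).Infinite) : (B ∩ C).Infinite :=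
  (hA.sdiff h).mono fun _ hx => ⟨by_contra fun hB => hx.2 ⟨hx.1.1, hB⟩, hx.1.2⟩

theorem AlmostSubset.biInter {A : Set ℕ} {G : Finset (Set ℕ)} (h : ∀ B ∈ G, AlmostSubset A B) :
    AlmostSubset A (⋂ B ∈ G, B) := by
  refine (G.finite_toSet.biUnion h).subset fun x hx => ?_
  simp only [mem_sdiff, mem_iInter, not_forall] at hx
  obtain ⟨hxA, B, hB, hxB⟩ := hx
  exact mem_biUnion hB ⟨hxA, hxB⟩

/-- A nonempty finite chain for `⊆*` has a least member. -/
theorem exists_almostSubset_least (G : Finset (Set ℕ)) (hG : G.Nonempty)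
    (hchain : ∀ A ∈ G, ∀ B ∈ G, AlmostSubset A B ∨ AlmostSubset B A) :
    ∃ A ∈ G, ∀ B ∈ G, AlmostSubset A B := by
  classical
  induction hG using Finset.Nonempty.cons_induction with
  | singleton A => exact ⟨A, by simp, by simp [AlmostSubset]⟩
  | cons A G hA hG ih =>
    obtain ⟨C, hC, hCG⟩ := ih fun X hX Y hY =>
      hchain X (Finset.mem_cons_of_mem hX) Y (Finset.mem_cons_of_mem hY)
    rcases hchain A (Finset.mem_cons_self A G) C (Finset.mem_cons_of_mem hC) with h | h
    · refine ⟨A, Finset.mem_cons_self A G, fun B hB => ?_⟩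
      rcases Finset.mem_cons.1 hB with rfl | hB
      · exact .of_subset Subset.rfl
      · exact h.trans (hCG B hB)
    · refine ⟨C, Finset.mem_cons_of_mem hC, fun B hB => ?_⟩
      rcases Finset.mem_cons.1 hB with rfl | hB
      · exact h
      · exact hCG B hB

theorem sfip_of_chain {F : Set (Set ℕ)} (hinf : ∀ A ∈ F, A.Infinite)
    (hchain : ∀ A ∈ F, ∀ B ∈ F, AlmostSubset A B ∨ AlmostSubset B A) : SFIP F := by
  intro G hG hne
  obtain ⟨A, hA, hAG⟩ := exists_almostSubset_least G hne fun A hA B hB =>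
    hchain A (hG hA) B (hG hB)
  have := (AlmostSubset.biInter hAG).infinite_inter (C := univ) (by simpa using hinf A (hG hA))
  simpa using this

/-- No family of functions `ℕ → ℕ` indexed by `κ` is eventually strictly dominating. -/
def NotDominating (κ : Type*) : Prop :=
  ∀ f : κ → ℕ → ℕ, ∃ g : ℕ → ℕ, ∀ k, ∃ᶠ n in Filter.atTop, f k n ≤ g n

theorem notDominating_unit : NotDominating Unit := fun f =>
  ⟨f (), fun _ => Filter.Frequently.of_forall fun _ => le_rfl⟩

theorem NotDominating.of_surjective {ι κ : Type*} (h : NotDominating ι) {e : ι → κ}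
    (he : e.Surjective) : NotDominating κ := fun f => by
  obtain ⟨g, hg⟩ := h (f ∘ e)
  exact ⟨g, he.forall.2 hg⟩

/-- A decreasing sequence of sets meeting every `B k` in an infinite set has a pseudointersection
with the same property. -/
theorem NotDominating.exists_pseudointersection_of_antitone {κ : Type*} (h : NotDominating κ)
    (B : κ → Set ℕ) {C : ℕ → Set ℕ} (hC : Antitone C) (hCB : ∀ n k, (C n ∩ B k).Infinite) :
    ∃ T : Set ℕ, (∀ k, (T ∩ B k).Infinite) ∧ ∀ n, AlmostSubset T (C n) := by
  choose f hf hlt using fun k n => (hCB n k).exists_gt n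
  obtain ⟨g, hg⟩ := h f
  refine ⟨{x | ∃ n, x ∈ C n ∧ x ≤ g n}, fun k => ?_, fun n => ?_⟩
  · refine infinite_of_forall_exists_gt fun a => ?_
    obtain ⟨n, han, hn⟩ := Filter.frequently_atTop.1 (hg k) a
    exact ⟨f k n, ⟨⟨n, (hf k n).1, hn⟩, (hf k n).2⟩, han.trans_lt (hlt k n)⟩
  · refine ((finite_lt_nat n).biUnion fun m _ => finite_le_nat (g m)).subset ?_
    rintro x ⟨⟨m, hxm, hxg⟩, hxn⟩
    exact mem_biUnion (show m < n by by_contra! hmn; exact hxn (hC hmn hxm)) hxg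

theorem NotDominating.exists_pseudointersection_of_countable {κ : Type*} (h : NotDominating κ)
    (B : κ → Set ℕ) (hB : ∀ k, (B k).Infinite) {S : Set (Set ℕ)} (hS : S.Countable)
    (hchain : ∀ X ∈ S, ∀ Y ∈ S, AlmostSubset X Y ∨ AlmostSubset Y X)
    (hSB : ∀ X ∈ S, ∀ k, (X ∩ B k).Infinite) :
    ∃ T : Set ℕ, (∀ k, (T ∩ B k).Infinite) ∧ ∀ X ∈ S, AlmostSubset T X := by
  classical
  rcases S.eq_empty_or_nonempty with rfl | hne
  · exact ⟨univ, by simpa using hB, by simp⟩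
  obtain ⟨s, rfl⟩ := hS.exists_eq_range hne
  let G : ℕ → Finset (Set ℕ) := fun n => (Finset.range (n + 1)).image s
  have hG : ∀ {n X}, X ∈ G n → X ∈ range s := fun hX => by
    obtain ⟨i, -, rfl⟩ := Finset.mem_image.1 hX
    exact mem_range_self i
  obtain ⟨T, hTB, hT⟩ := h.exists_pseudointersection_of_antitone B (C := fun n => ⋂ X ∈ G n, X)
    (fun m n hmn => biInter_subset_biInter_left
      (Finset.coe_subset.2 (Finset.image_subset_image (by gcongr)))) (fun n k => by
      obtain ⟨A, hA, hAG⟩ := exists_almostSubset_least (G n) (by simp [G]) fun X hX Y hY =>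
        hchain X (hG hX) Y (hG hY)
      exact (AlmostSubset.biInter hAG).infinite_inter (hSB A (hG hA) k))
  refine ⟨T, hTB, forall_mem_range.2 fun n => (hT n).trans (.of_subset ?_)⟩
  exact biInter_subset_of_mem (Finset.mem_image_of_mem s (by simp))

/-- Recursive construction of `⊆*`-decreasing sequences all of whose terms meet every `B k` in an
infinite set and satisfy prescribed requirements `R i`. -/
theorem NotDominating.exists_decreasing {κ ι : Type*} [LinearOrder ι] [WellFoundedLT ι]
    (hι : ∀ i : ι, (Iio i).Countable) (h : NotDominating κ)
    (B : κ → Set ℕ) (hB : ∀ k, (B k).Infinite) (R : ι → Set ℕ → Prop)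
    (hR : ∀ i X, (∀ k, (X ∩ B k).Infinite) → ∃ Y ⊆ X, (∀ k, (Y ∩ B k).Infinite) ∧ R i Y) :
    ∃ T : ι → Set ℕ, (∀ i j, i < j → AlmostSubset (T j) (T i)) ∧
      ∀ i, (∀ k, (T i ∩ B k).Infinite) ∧ R i (T i) := by
  classical
  let P (i : ι) (T : ∀ j, j < i → Set ℕ) (Y : Set ℕ) : Prop :=
    (∀ j hj, AlmostSubset Y (T j hj)) ∧ (∀ k, (Y ∩ B k).Infinite) ∧ R i Y
  let T : ι → Set ℕ := (wellFounded_lt (α := ι)).fix fun i T =>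
    if hP : ∃ Y, P i T Y then hP.choose else univ
  have hT : ∀ i, P i (fun j _ => T j) (T i) := fun i => by
    induction i using WellFoundedLT.induction with
    | ind i ih =>
      have hex : ∃ Y, P i (fun j _ => T j) Y := by
        obtain ⟨X, hXB, hX⟩ := h.exists_pseudointersection_of_countable B hB
          (S := T '' Iio i) ((hι i).image T)
          (by
            rintro _ ⟨a, ha, rfl⟩ _ ⟨b, hb, rfl⟩
            rcases lt_trichotomy a b with hab | rfl | hab
            · exact .inr ((ih b hb).1 a hab)
            · exact .inl (.of_subset Subset.rfl)
            · exact .inl ((ih a ha).1 b hab))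
          (by
            rintro _ ⟨a, ha, rfl⟩
            exact (ih a ha).2.1)
        obtain ⟨Y, hYX, hYB, hY⟩ := hR i X hXB
        exact ⟨Y, fun j hj => (AlmostSubset.of_subset hYX).trans (hX _ (mem_image_of_mem T hj)),
          hYB, hY⟩
      have hTi : T i = hex.choose := by
        rw [show T i = _ from WellFounded.fix_eq _ _ i]
        exact dif_pos hex
      rw [hTi]
      exact hex.choose_spec
  exact ⟨T, fun i j hij => (hT j).1 i hij, fun i => (hT i).2⟩

/-- Every infinite set of naturals has an infinite subset whose gaps exceed `f`. -/
theorem exists_sparse_subset (f : ℕ → ℕ) {X : Set ℕ} (hX : X.Infinite) :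
    ∃ Y ⊆ X, Y.Infinite ∧ ∀ a ∈ Y, ∀ b ∈ Y, a < b → f a ≤ b := by
  choose c hcX hc using fun n => hX.exists_gt (max n (f n))
  let x : ℕ → ℕ := fun n => n.rec (c 0) fun _ y => c y
  have hx : StrictMono x := strictMono_nat_of_lt_succ fun n =>
    (le_max_left _ _).trans_lt (hc (x n))
  refine ⟨range x, ?_, infinite_range_of_injective hx.injective, ?_⟩
  · rintro _ ⟨n, rfl⟩
    cases n <;> exact hcX _
  · rintro _ ⟨m, rfl⟩ _ ⟨n, rfl⟩ hmn
    exact ((le_max_right _ _).trans (hc (x m)).le).trans (hx.monotone (hx.lt_iff_lt.1 hmn))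

section Towers

variable {ι : Type} [LinearOrder ι] [WellFoundedLT ι]

/-- Every `⊆*`-decreasing sequence of infinite sets indexed by `ι` has a pseudointersection. -/
def NoTower (ι : Type) [LinearOrder ι] : Prop :=
  ∀ T : ι → Set ℕ, (∀ i, (T i).Infinite) → (∀ i j, i < j → AlmostSubset (T j) (T i)) →
    HasPseudointersection (range T)

theorem NoTower.notDominating (hι : ∀ i : ι, (Iio i).Countable) (h : NoTower ι) :
    NotDominating ι := fun f => by
  obtain ⟨T, hT, hTi⟩ := notDominating_unit.exists_decreasing hι (fun _ => univ)
    (fun _ => infinite_univ) (fun i Y => ∀ a ∈ Y, ∀ b ∈ Y, a < b → f i a ≤ b) fun i X hX => by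
      obtain ⟨Y, hYX, hY, hYf⟩ := exists_sparse_subset (f i) (by simpa using hX ())
      exact ⟨Y, hYX, by simpa using hY, hYf⟩
  obtain ⟨X, hX, hXT⟩ := h T (fun i => by simpa using (hTi i).1 ()) hT
  choose g hgX hg using fun n => hX.exists_gt n
  refine ⟨g, fun i => Filter.frequently_atTop.2 fun a => ?_⟩
  obtain ⟨N, hN⟩ := (hXT _ (mem_range_self i)).bddAbove
  have hmem : ∀ x ∈ X, N < x → x ∈ T i := fun x hx hNx =>
    by_contra fun hxT => hNx.not_ge (hN ⟨hx, hxT⟩)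
  obtain ⟨n, hnX, hn⟩ := hX.exists_gt (max a N)
  have hNn := (le_max_right a N).trans_lt hn
  exact ⟨n, (le_max_left a N).trans hn.le, (hTi i).2 n (hmem n hnX hNn) (g n)
    (hmem _ (hgX n) (hNn.trans (hg n))) (hg n)⟩

theorem NoTower.hasPseudointersection (hι : ∀ i : ι, (Iio i).Countable) [Infinite ι]
    (h : NoTower ι) {A : ι → Set ℕ} (hA : SFIP (range A)) :
    HasPseudointersection (range A) := by
  classical
  obtain ⟨e⟩ : Nonempty (ι ≃ Finset ι) := Cardinal.eq.1 (mk_finset_of_infinite ι).symm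
  have hinf : ∀ s : Finset ι, (⋂ i ∈ s, A i).Infinite := fun s => by
    rcases s.eq_empty_or_nonempty with rfl | hs
    · simpa using infinite_univ
    · simpa using hA (s.image A) (by simp) (hs.image A)
  obtain ⟨T, hT, hTi⟩ := ((h.notDominating hι).of_surjective e.surjective).exists_decreasing hι
    (fun s => ⋂ i ∈ s, A i) hinf (fun i Y => Y ⊆ A i) fun i X hX =>
      ⟨X ∩ A i, inter_subset_left, fun s => by
        simpa [inter_assoc] using hX (insert i s), inter_subset_right⟩
  obtain ⟨X, hX, hXT⟩ := h T (fun i => by simpa using (hTi i).1 ∅) hT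
  exact ⟨X, hX, forall_mem_range.2 fun i =>
    (hXT _ (mem_range_self i)).trans (.of_subset (hTi i).2)⟩

end Towers

/-- (Rothberger) If `𝔭 = ℵ₁` then `𝔱 = ℵ₁`, i.e. `𝔭 = 𝔱`. -/
theorem rothberger (h : pseudoNum = Cardinal.aleph 1) :
    towerNum = Cardinal.aleph 1 ∧ pseudoNum = towerNum := by
  suffices ht : towerNum = aleph 1 from ⟨ht, h.trans ht.symm⟩
  obtain ⟨F, -, hF, hFp, hFc⟩ := csInf_mem (s := { c | ∃ F : Set (Set ℕ), (∀ A ∈ F, A.Infinite) ∧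
    SFIP F ∧ ¬ HasPseudointersection F ∧ c = #↥F }) <| nonempty_iff_ne_empty.2 fun hempty => by
      rw [pseudoNum, hempty, Cardinal.sInf_empty] at h
      exact (aleph_pos 1).ne h
  let ι : Type := (aleph 1).ord.ToType
  have hmk : #ι = aleph 1 := by simp [ι]
  have hcount : ∀ i : ι, (Iio i).Countable := fun i =>
    le_aleph0_iff_set_countable.1 <| lt_aleph_one_iff.1 <|
      (mk_Iio_lt i (by simp [ι])).trans_eq hmk
  have : Infinite ι := infinite_iff.2 (hmk ▸ aleph0_le_aleph 1)
  obtain ⟨e⟩ : Nonempty (ι ≃ F) := Cardinal.eq.1 (hmk.trans (h.symm.trans hFc))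
  have hrange : range (fun i => (e i : Set ℕ)) = F := by
    rw [show (fun i => (e i : Set ℕ)) = Subtype.val ∘ e from rfl, e.surjective.range_comp,
      Subtype.range_coe]
  have hNT : ¬ NoTower ι := fun hNT =>
    hFp (hrange ▸ hNT.hasPseudointersection hcount (hrange.symm ▸ hF))
  simp only [NoTower, not_forall] at hNT
  obtain ⟨T, hTinf, hT, hTp⟩ := hNT
  have htower : #(range T) ∈ { c | ∃ F : Set (Set ℕ), (∀ A ∈ F, A.Infinite) ∧
      (∀ A ∈ F, ∀ B ∈ F, AlmostSubset A B ∨ AlmostSubset B A) ∧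
      ¬ HasPseudointersection F ∧ c = #↥F } := by
    refine ⟨range T, forall_mem_range.2 hTinf, ?_, hTp, rfl⟩
    rintro _ ⟨i, rfl⟩ _ ⟨j, rfl⟩
    rcases lt_trichotomy i j with hij | rfl | hij
    · exact .inr (hT i j hij)
    · exact .inl (.of_subset Subset.rfl)
    · exact .inl (hT j i hij)
  refine le_antisymm ((csInf_le' htower).trans (mk_range_le.trans hmk.le)) ?_
  rw [← h]
  refine le_csInf ⟨_, htower⟩ ?_
  rintro c ⟨G, hG, hchain, hGp, rfl⟩
  exact csInf_le' ⟨G, hG, sfip_of_chain hG hchain, hGp, rfl⟩
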